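/- For every even positive integer n and every integer d ≥ 1, in the random matching model (G the multigraph formed from d independent uniformly random perfect matchings of {1,…,n}) the following exact identity holds: E_{G,θ}[m₂(G,θ)] = 2^{-n} Σ_{L,R ⊆ {1,…,n}, L ∩ R = ∅} ( E_{M}[(-1)^{e_M(L,R)}] )^d, where the inner expectation E_M is over a single uniformly random perfect matching M of {1,…,n} and e_M(L,R) is the number of pairs of M with one endpoint in L and the other in R. -/

import Mathlib

open scoped BigOperators
open MeasureTheory

noncomputable section

/-- The amplitude `2^{-n} Σ_z (−1)^{Σ_{i<j} m_{ij} z_i z_j + Σ_i x_i z_i}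
Π_j exp(−i θ_j (−1)^{z_j})` of measuring the graph state of the multigraph with edge
multiplicities `m` in the X-Y plane product basis with angles `θ`, at outcome `x`. -/
def gsAmp (n : ℕ) (m : Fin n → Fin n → ℕ) (θ : Fin n → ℝ) (x : Fin n → Bool) : ℂ :=
  (1 / 2 ^ n : ℂ) * ∑ z : Fin n → Bool,
    (-1 : ℂ) ^ ((∑ i : Fin n, ∑ j : Fin n, if i < j ∧ z i ∧ z j then m i j else 0) +
        ∑ i : Fin n, (if x i ∧ z i then 1 else 0)) *
      ∏ j : Fin n, Complex.exp (-Complex.I * (θ j : ℂ) * (-1 : ℂ) ^ (if z j then 1 else 0))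

/-- The output probability `p_{G,θ}(x)`. -/
def gsProb (n : ℕ) (m : Fin n → Fin n → ℕ) (θ : Fin n → ℝ) (x : Fin n → Bool) : ℝ :=
  Complex.normSq (gsAmp n m θ x)

/-- The normalized second moment `m₂(G,θ) = 2^n Σ_x p_{G,θ}(x)²`. -/
def secondMoment (n : ℕ) (m : Fin n → Fin n → ℕ) (θ : Fin n → ℝ) : ℝ :=
  2 ^ n * ∑ x : Fin n → Bool, (gsProb n m θ x) ^ 2

/-- The uniform average `(2π)^{-n} ∫_{[0,2π]^n} m₂(G,θ) dθ` over measurement angles. -/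
def avgSecondMoment (n : ℕ) (m : Fin n → Fin n → ℕ) : ℝ :=
  ((2 * Real.pi) ^ n)⁻¹ *
    ∫ θ in Set.univ.pi (fun _ : Fin n => Set.Icc (0 : ℝ) (2 * Real.pi)), secondMoment n m θ

/-- The perfect matchings of a finite set `V`, encoded as fixed-point-free involutions. -/
def perfectMatchings (V : Type*) [Fintype V] [DecidableEq V] : Finset (Equiv.Perm V) :=
  Finset.univ.filter fun σ => (∀ v, σ (σ v) = v) ∧ ∀ v, σ v ≠ v

/-- The multigraph of the matching model built from `d` perfect matchings `f 1, …, f d` of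
`{1,…,n}`: the multiplicity between `i ≠ i'` is the number of `k` with `{i,i'} ∈ M_k`. -/
def matchingMult (n d : ℕ) (f : Fin d → Equiv.Perm (Fin n)) : Fin n → Fin n → ℕ :=
  fun i i' => (Finset.univ.filter fun k : Fin d => f k i = i').card

/-- `E_{G,θ}[m₂(G,θ)]` for the random matching model: the average over `d` independent
uniformly random perfect matchings of `{1,…,n}` and the uniform angle average. -/
def matchingAvgM2 (n d : ℕ) : ℝ :=
  (∑ f ∈ Fintype.piFinset (fun _ : Fin d => perfectMatchings (Fin n)),
      avgSecondMoment n (matchingMult n d f)) /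
    (((perfectMatchings (Fin n)).card : ℝ) ^ d)

/-- `e_M(L,R)` for a perfect matching `σ` and disjoint sets `L`, `R`: the number of
pairs of the matching with one endpoint in `L` and the other in `R`. -/
def crossCount {V : Type*} [Fintype V] [DecidableEq V] (σ : Equiv.Perm V) (L R : Finset V) : ℕ :=
  (L.filter fun x => σ x ∈ R).card

/-- The sign `(-1)^b` as an integer. -/
def boolSign (b : Bool) : ℤ := if b then -1 else 1

/-- The charge of four copies of a bit: two entering with sign `+`, two with sign `-`. -/
def quadCharge (a b c e : Bool) : ℤ := boolSign a + boolSign b - boolSign c - boolSign e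

/-- The sign contributed by the edges of the multigraph at the bit string `z`. -/
def edgeSign (n : ℕ) (m : Fin n → Fin n → ℕ) (z : Fin n → Bool) : ℝ :=
  ∏ i, ∏ j, if i < j ∧ z i ∧ z j then (-1) ^ m i j else 1

/-- The character `(-1)^{x·z}`. -/
def bitChar (n : ℕ) (x z : Fin n → Bool) : ℝ := ∏ i, if x i ∧ z i then -1 else 1

theorem gsAmp_eq (n : ℕ) (m : Fin n → Fin n → ℕ) (θ : Fin n → ℝ) (x : Fin n → Bool) :
    gsAmp n m θ x = (1 / 2 ^ n : ℂ) * ∑ z : Fin n → Bool,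
      ((edgeSign n m z * bitChar n x z : ℝ) : ℂ) *
        ∏ j, Complex.exp (-Complex.I * θ j * (boolSign (z j) : ℤ)) := by
  unfold gsAmp edgeSign bitChar boolSign
  congr 1
  refine Finset.sum_congr rfl fun z _ => ?_
  congr 1
  · rw [pow_add, ← Finset.prod_pow_eq_pow_sum, ← Finset.prod_pow_eq_pow_sum]
    push_cast
    congr 1
    · refine Finset.prod_congr rfl fun i _ => ?_
      rw [← Finset.prod_pow_eq_pow_sum]
      refine Finset.prod_congr rfl fun j _ => ?_
      split_ifs <;> simp
    · refine Finset.prod_congr rfl fun i _ => ?_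
      split_ifs <;> simp
  · refine Finset.prod_congr rfl fun j _ => ?_
    cases z j <;> simp

theorem conj_gsAmp_eq (n : ℕ) (m : Fin n → Fin n → ℕ) (θ : Fin n → ℝ) (x : Fin n → Bool) :
    (starRingEnd ℂ) (gsAmp n m θ x) = (1 / 2 ^ n : ℂ) * ∑ z : Fin n → Bool,
      ((edgeSign n m z * bitChar n x z : ℝ) : ℂ) *
        ∏ j, Complex.exp (Complex.I * θ j * (boolSign (z j) : ℤ)) := by
  rw [gsAmp_eq]
  simp only [map_mul, map_sum, map_prod, ← Complex.exp_conj, Complex.conj_ofReal, map_neg,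
    Complex.conj_I, map_div₀, map_one, map_pow, map_ofNat, map_intCast, neg_neg]

theorem gsProb_sq_eq (n : ℕ) (m : Fin n → Fin n → ℕ) (θ : Fin n → ℝ) (x : Fin n → Bool) :
    ((gsProb n m θ x ^ 2 : ℝ) : ℂ) = (1 / 2 ^ n : ℂ) ^ 4 *
      ∑ a : Fin n → Bool, ∑ b : Fin n → Bool, ∑ c : Fin n → Bool, ∑ e : Fin n → Bool,
      ((edgeSign n m a * edgeSign n m b * edgeSign n m c * edgeSign n m e *
        (bitChar n x a * bitChar n x b * bitChar n x c * bitChar n x e) : ℝ) : ℂ) *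
        ∏ j, Complex.exp (-Complex.I * θ j * (quadCharge (a j) (b j) (c j) (e j) : ℤ)) := by
  have h : ((gsProb n m θ x ^ 2 : ℝ) : ℂ) = gsAmp n m θ x * gsAmp n m θ x *
      ((starRingEnd ℂ) (gsAmp n m θ x) * (starRingEnd ℂ) (gsAmp n m θ x)) := by
    unfold gsProb
    push_cast
    rw [← Complex.mul_conj]
    ring
  have key : ∀ (k : ℂ) (F G : (Fin n → Bool) → ℂ),
      k * (∑ z, F z) * (k * ∑ z, F z) * (k * (∑ z, G z) * (k * ∑ z, G z)) =
      k ^ 4 * ∑ a, ∑ b, ∑ c, ∑ e, F a * F b * G c * G e := by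
    intro k F G
    simp only [← Finset.mul_sum, ← Finset.sum_mul]
    ring
  rw [h, conj_gsAmp_eq, gsAmp_eq, key]
  congr 1
  refine Finset.sum_congr rfl fun a _ => Finset.sum_congr rfl fun b _ =>
    Finset.sum_congr rfl fun c _ => Finset.sum_congr rfl fun e _ => ?_
  have hp : (∏ j, Complex.exp (-Complex.I * θ j * (quadCharge (a j) (b j) (c j) (e j) : ℤ))) =
      (∏ j, Complex.exp (-Complex.I * θ j * (boolSign (a j) : ℤ))) *
      (∏ j, Complex.exp (-Complex.I * θ j * (boolSign (b j) : ℤ))) *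
      (∏ j, Complex.exp (Complex.I * θ j * (boolSign (c j) : ℤ))) *
      (∏ j, Complex.exp (Complex.I * θ j * (boolSign (e j) : ℤ))) := by
    simp only [← Finset.prod_mul_distrib, ← Complex.exp_add]
    refine Finset.prod_congr rfl fun j _ => ?_
    congr 1
    unfold quadCharge
    push_cast
    ring
  rw [hp]
  push_cast
  ring

theorem integral_exp_int_mul (k : ℤ) :
    ∫ t in Set.Icc (0 : ℝ) (2 * Real.pi), Complex.exp (-Complex.I * t * k) =
      if k = 0 then (2 * Real.pi : ℂ) else 0 := by
  have hpi : (0 : ℝ) ≤ 2 * Real.pi := by positivity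
  rw [integral_Icc_eq_integral_Ioc, ← intervalIntegral.integral_of_le hpi]
  split_ifs with hk
  · simp [hk]
  · have hc : (-Complex.I * k : ℂ) ≠ 0 := by simp [hk]
    have : ∀ t : ℝ, (-Complex.I * t * k : ℂ) = (-Complex.I * k) * t := fun t => by ring
    simp only [this]
    rw [integral_exp_mul_complex hc]
    have h2 : (-Complex.I * k * ((2 * Real.pi : ℝ) : ℂ)) = ((-k : ℤ) : ℂ) * (2 * Real.pi * Complex.I) := by
      push_cast; ring
    rw [h2, Complex.exp_int_mul_two_pi_mul_I]
    simp

theorem integral_prod_exp_int_mul (n : ℕ) (k : Fin n → ℤ) :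
    ∫ θ in Set.univ.pi (fun _ : Fin n => Set.Icc (0 : ℝ) (2 * Real.pi)),
      ∏ j, Complex.exp (-Complex.I * θ j * k j) =
      (2 * Real.pi : ℂ) ^ n * if k = 0 then 1 else 0 := by
  rw [volume_pi, Measure.restrict_pi_pi]
  rw [integral_fintype_prod_eq_prod (𝕜 := ℂ)
    (f := fun j (t : ℝ) => Complex.exp (-Complex.I * t * k j))]
  simp only [integral_exp_int_mul]
  split_ifs with hk
  · simp [hk]
  · obtain ⟨j, hj⟩ := Function.ne_iff.mp hk
    rw [Finset.prod_eq_zero (Finset.mem_univ j)]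
    · simp
    · simpa using hj

theorem avgSecondMoment_eq_sum_charge (n : ℕ) (m : Fin n → Fin n → ℕ) :
    avgSecondMoment n m = 2 ^ n * ((1 / 2 ^ n) ^ 4 * ∑ x : Fin n → Bool,
      ∑ a : Fin n → Bool, ∑ b : Fin n → Bool, ∑ c : Fin n → Bool, ∑ e : Fin n → Bool,
      (edgeSign n m a * edgeSign n m b * edgeSign n m c * edgeSign n m e *
        (bitChar n x a * bitChar n x b * bitChar n x c * bitChar n x e)) *
        if (fun j => quadCharge (a j) (b j) (c j) (e j)) = 0 then 1 else 0) := by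
  have hpi : (2 * Real.pi : ℂ) ^ n ≠ 0 := by
    simp [Real.pi_ne_zero]
  have hint : ∀ (k : Fin n → ℤ) (s : ℂ), Integrable
      (fun θ : Fin n → ℝ => s * ∏ j, Complex.exp (-Complex.I * θ j * k j))
      (volume.restrict (Set.univ.pi fun _ : Fin n => Set.Icc (0 : ℝ) (2 * Real.pi))) := by
    intro k s
    refine ContinuousOn.integrableOn_compact (isCompact_univ_pi fun _ => isCompact_Icc) ?_
    fun_prop
  apply Complex.ofReal_injective
  unfold avgSecondMoment secondMoment
  rw [Complex.ofReal_mul, ← integral_complex_ofReal]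
  simp only [Complex.ofReal_mul, Complex.ofReal_sum, gsProb_sq_eq]
  rw [integral_const_mul, integral_finsetSum]
  swap
  · intro x _
    refine Integrable.const_mul ?_ _
    refine integrable_finsetSum _ fun a _ => integrable_finsetSum _ fun b _ =>
      integrable_finsetSum _ fun c _ => integrable_finsetSum _ fun e _ => hint _ _
  have hx : ∀ x : Fin n → Bool,
      ∫ θ in Set.univ.pi (fun _ : Fin n => Set.Icc (0 : ℝ) (2 * Real.pi)),
        (1 / 2 ^ n : ℂ) ^ 4 *
      ∑ a : Fin n → Bool, ∑ b : Fin n → Bool, ∑ c : Fin n → Bool, ∑ e : Fin n → Bool,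
      ((edgeSign n m a * edgeSign n m b * edgeSign n m c * edgeSign n m e *
        (bitChar n x a * bitChar n x b * bitChar n x c * bitChar n x e) : ℝ) : ℂ) *
        ∏ j, Complex.exp (-Complex.I * θ j * (quadCharge (a j) (b j) (c j) (e j) : ℤ)) =
      (2 * Real.pi : ℂ) ^ n * ((1 / 2 ^ n : ℂ) ^ 4 *
      ∑ a : Fin n → Bool, ∑ b : Fin n → Bool, ∑ c : Fin n → Bool, ∑ e : Fin n → Bool,
      ((edgeSign n m a * edgeSign n m b * edgeSign n m c * edgeSign n m e *
        (bitChar n x a * bitChar n x b * bitChar n x c * bitChar n x e) : ℝ) : ℂ) *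
        if (fun j => quadCharge (a j) (b j) (c j) (e j)) = 0 then 1 else 0) := by
    intro x
    rw [integral_const_mul, mul_left_comm]
    congr 1
    simp only [Finset.mul_sum]
    rw [integral_finsetSum _ fun a _ => integrable_finsetSum _ fun b _ =>
      integrable_finsetSum _ fun c _ => integrable_finsetSum _ fun e _ => hint _ _]
    refine Finset.sum_congr rfl fun a _ => ?_
    rw [integral_finsetSum _ fun b _ =>
      integrable_finsetSum _ fun c _ => integrable_finsetSum _ fun e _ => hint _ _]
    refine Finset.sum_congr rfl fun b _ => ?_
    rw [integral_finsetSum _ fun c _ => integrable_finsetSum _ fun e _ => hint _ _]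
    refine Finset.sum_congr rfl fun c _ => ?_
    rw [integral_finsetSum _ fun e _ => hint _ _]
    refine Finset.sum_congr rfl fun e _ => ?_
    rw [integral_const_mul, integral_prod_exp_int_mul, mul_left_comm]
  simp only [Complex.ofReal_mul] at hx
  rw [Finset.sum_congr rfl fun x _ => hx x, ← Finset.mul_sum, ← Finset.mul_sum]
  push_cast [apply_ite Complex.ofReal]
  field_simp

theorem quadCharge_eq_zero_iff (a u v b : Bool) :
    quadCharge a b (xor a u) (xor a v) = 0 ↔ b = xor a (xor u v) ∧ ¬(u ∧ v) := by
  revert a u v b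
  decide

/-- The sign contributed by the edges joining a vertex with `v = 1` to a vertex with `u = 1`. -/
def crossSign (n : ℕ) (m : Fin n → Fin n → ℕ) (v u : Fin n → Bool) : ℝ :=
  ∏ i, ∏ j, if i < j ∧ ((v i ∧ u j) ∨ (u i ∧ v j)) then (-1) ^ m i j else 1

theorem edgeSign_mul_four (n : ℕ) (m : Fin n → Fin n → ℕ) (a u v : Fin n → Bool)
    (h : ∀ j, ¬(u j ∧ v j)) :
    edgeSign n m a * edgeSign n m (fun j => xor (a j) (xor (u j) (v j))) *
      edgeSign n m (fun j => xor (a j) (u j)) * edgeSign n m (fun j => xor (a j) (v j)) =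
    crossSign n m v u := by
  unfold edgeSign crossSign
  simp only [← Finset.prod_mul_distrib]
  refine Finset.prod_congr rfl fun i _ => Finset.prod_congr rfl fun j _ => ?_
  have hi := h i
  have hj := h j
  by_cases hij : i < j
  · rcases neg_one_pow_eq_or ℝ (m i j) with hm | hm <;> rw [hm] <;>
    by_cases ai : a i <;> by_cases aj : a j <;> by_cases ui : u i <;> by_cases uj : u j <;>
    by_cases vi : v i <;> by_cases vj : v j <;> simp_all
  · simp [hij]

theorem bitChar_mul_four (n : ℕ) (x a u v : Fin n → Bool) :
    bitChar n x a * bitChar n x (fun j => xor (a j) (xor (u j) (v j))) *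
      bitChar n x (fun j => xor (a j) (u j)) * bitChar n x (fun j => xor (a j) (v j)) = 1 := by
  unfold bitChar
  simp only [← Finset.prod_mul_distrib]
  refine Finset.prod_eq_one fun i _ => ?_
  by_cases hx : x i <;> by_cases ha : a i <;> by_cases hu : u i <;> by_cases hv : v i <;>
    simp [hx, ha, hu, hv]

theorem sum_comp_xor {n : ℕ} (a : Fin n → Bool) (F : (Fin n → Bool) → ℝ) :
    ∑ c, F c = ∑ u : Fin n → Bool, F fun j => xor (a j) (u j) := by
  have hinv : Function.Involutive
      (fun u j => xor (a j) (u j) : (Fin n → Bool) → Fin n → Bool) := by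
    intro u
    ext j
    simp
  exact (Equiv.sum_comp hinv.toPerm F).symm

theorem avgSecondMoment_eq_sum_crossSign (n : ℕ) (m : Fin n → Fin n → ℕ) :
    avgSecondMoment n m = (1 / 2 ^ n) * ∑ v : Fin n → Bool, ∑ u : Fin n → Bool,
      if ∀ j, ¬(u j ∧ v j) then crossSign n m v u else 0 := by
  rw [avgSecondMoment_eq_sum_charge]
  have hxa : ∀ x a : Fin n → Bool, (∑ b : Fin n → Bool, ∑ c : Fin n → Bool, ∑ e : Fin n → Bool,
      (edgeSign n m a * edgeSign n m b * edgeSign n m c * edgeSign n m e *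
        (bitChar n x a * bitChar n x b * bitChar n x c * bitChar n x e)) *
        if (fun j => quadCharge (a j) (b j) (c j) (e j)) = 0 then (1 : ℝ) else 0) =
      ∑ v : Fin n → Bool, ∑ u : Fin n → Bool,
        if ∀ j, ¬(u j ∧ v j) then crossSign n m v u else 0 := by
    intro x a
    rw [Finset.sum_comm, sum_comp_xor a]
    conv_rhs => rw [Finset.sum_comm]
    refine Finset.sum_congr rfl fun u _ => ?_
    rw [Finset.sum_comm, sum_comp_xor a]
    refine Finset.sum_congr rfl fun v _ => ?_
    simp only [funext_iff, Pi.zero_apply, quadCharge_eq_zero_iff, forall_and]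
    rw [Finset.sum_eq_single fun j => xor (a j) (xor (u j) (v j))]
    · split_ifs with h1 h2 h2
      · rw [edgeSign_mul_four n m a u v h2, bitChar_mul_four]
        simp
      · exact absurd h1.2 h2
      · exact absurd ⟨fun _ => rfl, h2⟩ h1
      · simp
    · intro b _ hb
      rw [if_neg, mul_zero]
      exact fun h => hb (funext h.1)
    · simp
  simp only [hxa, Finset.sum_const, Finset.card_univ, Fintype.card_fun, Fintype.card_bool,
    Fintype.card_fin, nsmul_eq_mul]
  push_cast
  field_simp

theorem mem_perfectMatchings {V : Type*} [Fintype V] [DecidableEq V] {σ : Equiv.Perm V} :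
    σ ∈ perfectMatchings V ↔ (∀ v, σ (σ v) = v) ∧ ∀ v, σ v ≠ v := by
  simp [perfectMatchings]

theorem crossSign_matchingMult (n d : ℕ) (f : Fin d → Equiv.Perm (Fin n))
    (hf : ∀ k, f k ∈ perfectMatchings (Fin n)) (L R : Finset (Fin n)) (hLR : Disjoint L R) :
    crossSign n (matchingMult n d f) (fun j => decide (j ∈ L)) (fun j => decide (j ∈ R)) =
      ∏ k, (-1 : ℝ) ^ crossCount (f k) L R := by
  have hinv : ∀ k v, f k (f k v) = v := fun k v => (mem_perfectMatchings.mp (hf k)).1 v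
  have hsymm : ∀ i j, matchingMult n d f i j = matchingMult n d f j i := by
    intro i j
    unfold matchingMult
    congr 1
    ext k
    simp only [Finset.mem_filter, Finset.mem_univ, true_and]
    exact ⟨fun h => by rw [← h, hinv], fun h => by rw [← h, hinv]⟩
  have hcount : ∑ k, crossCount (f k) L R = ∑ i ∈ L, ∑ j ∈ R, matchingMult n d f i j := by
    unfold crossCount matchingMult
    simp only [Finset.card_filter]
    rw [Finset.sum_comm]
    refine Finset.sum_congr rfl fun i _ => ?_
    rw [Finset.sum_comm]
    refine Finset.sum_congr rfl fun k _ => ?_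
    simp
  rw [Finset.prod_pow_eq_pow_sum, hcount, ← Finset.prod_pow_eq_pow_sum]
  simp only [← Finset.prod_pow_eq_pow_sum]
  have hsplit : crossSign n (matchingMult n d f) (fun j => decide (j ∈ L))
      (fun j => decide (j ∈ R)) =
      (∏ i, ∏ j, if i < j ∧ i ∈ L ∧ j ∈ R then (-1 : ℝ) ^ matchingMult n d f i j else 1) *
      ∏ i, ∏ j, if i < j ∧ i ∈ R ∧ j ∈ L then (-1 : ℝ) ^ matchingMult n d f i j else 1 := by
    unfold crossSign
    simp only [← Finset.prod_mul_distrib]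
    refine Finset.prod_congr rfl fun i _ => Finset.prod_congr rfl fun j _ => ?_
    have hi : i ∈ L → i ∉ R := fun h => Finset.disjoint_left.mp hLR h
    simp only [decide_eq_true_eq]
    by_cases h1 : i ∈ L <;> by_cases h2 : i ∈ R <;> simp_all
  rw [hsplit, Finset.prod_comm (f := fun i j => if i < j ∧ i ∈ R ∧ j ∈ L then
    (-1 : ℝ) ^ matchingMult n d f i j else 1), ← Finset.prod_mul_distrib]
  simp only [← Finset.prod_mul_distrib]
  rw [← Finset.prod_subset (Finset.subset_univ L)]
  · refine Finset.prod_congr rfl fun i hi => ?_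
    rw [← Finset.prod_subset (Finset.subset_univ R)]
    · refine Finset.prod_congr rfl fun j hj => ?_
      have hne : i ≠ j := fun h => Finset.disjoint_left.mp hLR hi (h ▸ hj)
      rcases lt_or_gt_of_ne hne with h | h
      · simp [h, hi, hj, h.not_gt]
      · simp [h, hi, hj, h.not_gt, hsymm j i]
    · intro j _ hj
      simp [hj]
  · intro i _ hi
    simp [hi]

theorem sum_bool_fun_eq_sum_finset {n : ℕ} (F : (Fin n → Bool) → ℝ) :
    ∑ v, F v = ∑ L : Finset (Fin n), F fun j => decide (j ∈ L) := by
  refine (Fintype.sum_bijective (fun (L : Finset (Fin n)) (j : Fin n) => decide (j ∈ L))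
    ⟨fun L L' h => ?_, fun v => ⟨Finset.univ.filter fun j => v j, ?_⟩⟩ _ _ fun _ => rfl).symm
  · ext j
    simpa using congrFun h j
  · ext j
    simp

theorem avgSecondMoment_matchingMult (n d : ℕ) (f : Fin d → Equiv.Perm (Fin n))
    (hf : ∀ k, f k ∈ perfectMatchings (Fin n)) :
    avgSecondMoment n (matchingMult n d f) =
      (1 / 2 ^ n) * ∑ L : Finset (Fin n), ∑ R : Finset (Fin n),
        if Disjoint L R then ∏ k, (-1 : ℝ) ^ crossCount (f k) L R else 0 := by
  rw [avgSecondMoment_eq_sum_crossSign, sum_bool_fun_eq_sum_finset]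
  congr 1
  refine Finset.sum_congr rfl fun L _ => ?_
  rw [sum_bool_fun_eq_sum_finset]
  refine Finset.sum_congr rfl fun R _ => ?_
  have hiff : (∀ j, ¬(decide (j ∈ R) = true ∧ decide (j ∈ L) = true)) ↔ Disjoint L R := by
    simp only [decide_eq_true_eq, Finset.disjoint_left]
    exact ⟨fun h j hL hR => h j ⟨hR, hL⟩, fun h j hj => h hj.2 hj.1⟩
  by_cases hLR : Disjoint L R
  · rw [if_pos (hiff.2 hLR), if_pos hLR, crossSign_matchingMult n d f hf L R hLR]
  · rw [if_neg (mt hiff.1 hLR), if_neg hLR]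

/-- for every even `n > 0` and `d ≥ 1`, the average second moment of the
random matching model equals
`2^{-n} Σ_{L,R ⊆ [n], L ∩ R = ∅} (E_M[(-1)^{e_M(L,R)}])^d`. -/
theorem stmt_5 (n d : ℕ) (hn : 0 < n) (hne : Even n) (hd : 1 ≤ d) :
    matchingAvgM2 n d =
      (1 / 2 ^ n : ℝ) * ∑ L : Finset (Fin n), ∑ R : Finset (Fin n),
        if Disjoint L R then
          ((∑ σ ∈ perfectMatchings (Fin n), (-1 : ℝ) ^ crossCount σ L R) /
              ((perfectMatchings (Fin n)).card : ℝ)) ^ d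
        else 0 := by
  unfold matchingAvgM2
  rw [Finset.sum_congr rfl fun f hf =>
    avgSecondMoment_matchingMult n d f (Fintype.mem_piFinset.mp hf), ← Finset.mul_sum,
    mul_div_assoc]
  congr 1
  rw [Finset.sum_comm, Finset.sum_div]
  refine Finset.sum_congr rfl fun L _ => ?_
  rw [Finset.sum_comm, Finset.sum_div]
  refine Finset.sum_congr rfl fun R _ => ?_
  split_ifs
  · rw [← Finset.prod_univ_sum (fun _ : Fin d => perfectMatchings (Fin n))
      fun _ σ => (-1 : ℝ) ^ crossCount σ L R, Finset.prod_const, Finset.card_univ,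
      Fintype.card_fin, div_pow]
  · simp
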